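/- (Soundness of H4PrŁΔ) If a formula α ∈ L_4PrŁΔ is derivable from a set Ξ ⊆ L_4PrŁΔ in the Hilbert-style calculus H4PrŁΔ, then Ξ entails α in 4PrŁΔ semantics: every 4PrŁΔ model with e(γ)=1 for all γ∈Ξ satisfies e(α)=1. In particular, every instance of the axioms equiv, contr, neg, mon, part1, part2 and ex is 4PrŁΔ valid. -/

import Mathlib

inductive BD : Type where
  | var : ℕ → BD
  | neg : BD → BD
  | and : BD → BD → BD
  | or  : BD → BD → BD

structure BDModel (W : Type) where
  vpos : ℕ → Set W
  vneg : ℕ → Set W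

mutual
  def suppT {W : Type} (M : BDModel W) : BD → W → Prop
    | .var p, w => w ∈ M.vpos p
    | .neg φ, w => suppF M φ w
    | .and φ χ, w => suppT M φ w ∧ suppT M χ w
    | .or φ χ, w => suppT M φ w ∨ suppT M χ w
  def suppF {W : Type} (M : BDModel W) : BD → W → Prop
    | .var p, w => w ∈ M.vneg p
    | .neg φ, w => suppT M φ w
    | .and φ χ, w => suppF M φ w ∨ suppF M χ w
    | .or φ χ, w => suppF M φ w ∧ suppF M χ w
end

def extP {W : Type} (M : BDModel W) (φ : BD) : Set W := {w | suppT M φ w}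
def extN {W : Type} (M : BDModel W) (φ : BD) : Set W := {w | suppF M φ w}
/-- Pure belief extension |φ|^b = |φ|⁺ ∖ |φ|⁻. -/
def extB {W : Type} (M : BDModel W) (φ : BD) : Set W := extP M φ \ extN M φ
/-- Pure disbelief extension |φ|^d = |φ|⁻ ∖ |φ|⁺. -/
def extD {W : Type} (M : BDModel W) (φ : BD) : Set W := extN M φ \ extP M φ
/-- Conflict extension |φ|^c = |φ|⁺ ∩ |φ|⁻. -/
def extC {W : Type} (M : BDModel W) (φ : BD) : Set W := extP M φ ∩ extN M φ
/-- Uncertainty extension |φ|^u = W ∖ (|φ|⁺ ∪ |φ|⁻). -/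
def extU {W : Type} (M : BDModel W) (φ : BD) : Set W := (extP M φ ∪ extN M φ)ᶜ

/-- A BD model (on a nonempty carrier) with a 4-probability. -/
structure FourModel (W : Type) [Nonempty W] where
  M : BDModel W
  mu : Set W → ℝ
  mu_mem : ∀ X : Set W, mu X ∈ Set.Icc (0:ℝ) 1
  part : ∀ φ : BD, mu (extB M φ) + mu (extD M φ) + mu (extU M φ) + mu (extC M φ) = 1
  negb : ∀ φ : BD, mu (extB M (.neg φ)) = mu (extD M φ)
  negc : ∀ φ : BD, mu (extC M (.neg φ)) = mu (extC M φ)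
  contrb : ∀ φ : BD, mu (extB M (.and φ (.neg φ))) = 0
  contrc : ∀ φ : BD, mu (extC M (.and φ (.neg φ))) = mu (extC M φ)
  bcmon : ∀ φ ψ : BD, extP M φ ⊆ extP M ψ → extN M ψ ⊆ extN M φ →
    mu (extB M φ) + mu (extC M φ) ≤ mu (extB M ψ) + mu (extC M ψ)
  bcex : ∀ φ ψ : BD,
    mu (extB M φ) + mu (extC M φ) + mu (extB M ψ) + mu (extC M ψ) =
      mu (extB M (.and φ ψ)) + mu (extC M (.and φ ψ)) +
        mu (extB M (.or φ ψ)) + mu (extC M (.or φ ψ))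

/-- The language L_4PrŁΔ: α ::= Bl φ | Db φ | Cf φ | Uc φ | ∼α | Δα | (α→α). -/
inductive FourF : Type where
  | bl : BD → FourF
  | db : BD → FourF
  | cf : BD → FourF
  | uc : BD → FourF
  | snot : FourF → FourF
  | delta : FourF → FourF
  | imp : FourF → FourF → FourF

open Classical in
/-- Evaluation of L_4PrŁΔ formulas in a 4PrŁΔ model (standard Ł_Δ operations). -/
noncomputable def fe {W : Type} [Nonempty W] (F : FourModel W) : FourF → ℝ
  | .bl φ => F.mu (extB F.M φ)
  | .db φ => F.mu (extD F.M φ)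
  | .cf φ => F.mu (extC F.M φ)
  | .uc φ => F.mu (extU F.M φ)
  | .snot α => 1 - fe F α
  | .delta α => if fe F α = 1 then 1 else 0
  | .imp α β => min 1 (1 - fe F α + fe F β)

/-- 4PrŁΔ validity: value 1 in every model. -/
def FourValid (α : FourF) : Prop :=
  ∀ (W : Type) (_ : Nonempty W) (F : FourModel W), fe F α = 1

/-- α⊕β := ∼α→β in L_4PrŁΔ. -/
def FourF.oplus (α β : FourF) : FourF := .imp (.snot α) β
/-- α⊙β := ∼(α→∼β) in L_4PrŁΔ. -/
def FourF.odot (α β : FourF) : FourF := .snot (.imp α (.snot β))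
/-- α⊖β := α⊙∼β in L_4PrŁΔ. -/
def FourF.ominus (α β : FourF) : FourF := α.odot (.snot β)
/-- α↔β := (α→β)⊙(β→α) in L_4PrŁΔ. -/
def FourF.biimp (α β : FourF) : FourF := FourF.odot (.imp α β) (.imp β α)
/-- BD entailment: φ⊨χ iff in every BD model |φ|⁺⊆|χ|⁺ and |χ|⁻⊆|φ|⁻. -/
def BDentails (φ χ : BD) : Prop :=
  ∀ (W : Type) (_ : Nonempty W) (M : BDModel W),
    extP M φ ⊆ extP M χ ∧ extN M χ ⊆ extN M φ

open Classical in
/-- Evaluation of an L_4PrŁΔ formula under an arbitrary Ł_Δ assignment g of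
values to modal atoms (the catch-all case applies exactly to atoms
Bl φ, Db φ, Cf φ, Uc φ). -/
noncomputable def lEval (g : FourF → ℝ) : FourF → ℝ
  | .snot α => 1 - lEval g α
  | .delta α => if lEval g α = 1 then 1 else 0
  | .imp α β => min 1 (1 - lEval g α + lEval g β)
  | a => g a

/-- L_4PrŁΔ instances of Ł_Δ-valid formulas: formulas taking value 1 under
every assignment of values from [0,1] to their modal atoms. -/
def LDValid4 (α : FourF) : Prop :=
  ∀ g : FourF → ℝ, (∀ a, g a ∈ Set.Icc (0:ℝ) 1) → lEval g α = 1

/-- The four modalities of L_4PrŁΔ. -/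
inductive Modality : Type where
  | bl | db | cf | uc
  deriving DecidableEq

def Modality.ap : Modality → BD → FourF
  | .bl => FourF.bl
  | .db => FourF.db
  | .cf => FourF.cf
  | .uc => FourF.uc

/-- The Hilbert-style calculus H4PrŁΔ. -/
inductive Deriv : Set FourF → FourF → Prop where
  | premise {Ξ : Set FourF} {α : FourF} : α ∈ Ξ → Deriv Ξ α
  | lax {Ξ : Set FourF} {α : FourF} : LDValid4 α → Deriv Ξ α
  | equiv {Ξ : Set FourF} (X : Modality) {φ χ : BD} :
      BDentails φ χ → BDentails χ φ → Deriv Ξ (FourF.biimp (X.ap φ) (X.ap χ))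
  | contr1 {Ξ : Set FourF} (φ : BD) : Deriv Ξ (.snot (.bl (.and φ (.neg φ))))
  | contr2 {Ξ : Set FourF} (φ : BD) :
      Deriv Ξ (FourF.biimp (.cf φ) (.cf (.and φ (.neg φ))))
  | negax1 {Ξ : Set FourF} (φ : BD) : Deriv Ξ (FourF.biimp (.bl (.neg φ)) (.db φ))
  | negax2 {Ξ : Set FourF} (φ : BD) : Deriv Ξ (FourF.biimp (.cf (.neg φ)) (.cf φ))
  | mon {Ξ : Set FourF} {φ χ : BD} : BDentails φ χ →
      Deriv Ξ (.imp ((FourF.bl φ).oplus (.cf φ)) ((FourF.bl χ).oplus (.cf χ)))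
  | part1 {Ξ : Set FourF} (φ : BD) :
      Deriv Ξ ((((FourF.bl φ).oplus (.db φ)).oplus (.cf φ)).oplus (.uc φ))
  | part2 {Ξ : Set FourF} (X1 X2 X3 X4 : Modality) (φ : BD)
      (h12 : X1 ≠ X2) (h13 : X1 ≠ X3) (h14 : X1 ≠ X4)
      (h23 : X2 ≠ X3) (h24 : X2 ≠ X4) (h34 : X3 ≠ X4) :
      Deriv Ξ (FourF.biimp
        (FourF.ominus
          ((((X1.ap φ).oplus (X2.ap φ)).oplus (X3.ap φ)).oplus (X4.ap φ)) (X4.ap φ))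
        (((X1.ap φ).oplus (X2.ap φ)).oplus (X3.ap φ)))
  | exax {Ξ : Set FourF} (φ χ : BD) :
      Deriv Ξ (FourF.biimp
        ((FourF.bl (.or φ χ)).oplus (.cf (.or φ χ)))
        (FourF.oplus
          (FourF.ominus ((FourF.bl φ).oplus (.cf φ))
            ((FourF.bl (.and φ χ)).oplus (.cf (.and φ χ))))
          ((FourF.bl χ).oplus (.cf χ))))
  | mp {Ξ : Set FourF} {α β : FourF} : Deriv Ξ α → Deriv Ξ (.imp α β) → Deriv Ξ β
  | dnec {Ξ : Set FourF} {α : FourF} : Deriv ∅ α → Deriv Ξ (.delta α)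

/-- Semantic entailment in 4PrŁΔ. -/
def FourEntails (Ξ : Set FourF) (α : FourF) : Prop :=
  ∀ (W : Type) (_ : Nonempty W) (F : FourModel W),
    (∀ γ ∈ Ξ, fe F γ = 1) → fe F α = 1

theorem fe_mem_Icc {W : Type} [Nonempty W] (F : FourModel W) (α : FourF) :
    fe F α ∈ Set.Icc (0 : ℝ) 1 := by
  induction α with
  | bl φ => exact F.mu_mem _
  | db φ => exact F.mu_mem _
  | cf φ => exact F.mu_mem _
  | uc φ => exact F.mu_mem _
  | snot α ih =>
    simp only [fe, Set.mem_Icc] at ih ⊢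
    constructor <;> linarith [ih.1, ih.2]
  | delta α ih =>
    simp only [fe, Set.mem_Icc]
    split_ifs <;> norm_num
  | imp α β ihα ihβ =>
    simp only [fe, Set.mem_Icc] at ihα ihβ ⊢
    exact ⟨le_min zero_le_one (by linarith [ihα.2, ihβ.1]), min_le_left _ _⟩

theorem lEval_fe {W : Type} [Nonempty W] (F : FourModel W) (α : FourF) :
    lEval (fe F) α = fe F α := by
  induction α with
  | bl φ => simp only [lEval]
  | db φ => simp only [lEval]
  | cf φ => simp only [lEval]
  | uc φ => simp only [lEval]
  | snot α ih => simp only [lEval, fe, ih]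
  | delta α ih => simp only [lEval, fe, ih]
  | imp α β ihα ihβ => simp only [lEval, fe, ihα, ihβ]

theorem fe_oplus {W : Type} [Nonempty W] (F : FourModel W) (α β : FourF) :
    fe F (α.oplus β) = min 1 (fe F α + fe F β) := by
  simp only [FourF.oplus, fe, sub_sub_cancel]

theorem fe_ominus {W : Type} [Nonempty W] (F : FourModel W) (α β : FourF) :
    fe F (α.ominus β) = max 0 (fe F α - fe F β) := by
  simp only [FourF.ominus, FourF.odot, fe]
  grind

theorem fe_biimp_eq_one {W : Type} [Nonempty W] (F : FourModel W) {α β : FourF}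
    (h : fe F α = fe F β) : fe F (α.biimp β) = 1 := by
  simp [FourF.biimp, FourF.odot, fe, h]

theorem fe_imp_eq_one {W : Type} [Nonempty W] (F : FourModel W) {α β : FourF}
    (h : fe F α ≤ fe F β) : fe F (.imp α β) = 1 :=
  min_eq_left (by linarith)

theorem fe_bl_add_fe_cf_le_one {W : Type} [Nonempty W] (F : FourModel W) (φ : BD) :
    fe F (.bl φ) + fe F (.cf φ) ≤ 1 := by
  have hp := F.part φ
  have hd := (F.mu_mem (extD F.M φ)).1
  have hu := (F.mu_mem (extU F.M φ)).1
  simp only [fe]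
  linarith

theorem fe_bl_oplus_cf {W : Type} [Nonempty W] (F : FourModel W) (φ : BD) :
    fe F ((FourF.bl φ).oplus (.cf φ)) = fe F (.bl φ) + fe F (.cf φ) := by
  rw [fe_oplus, min_eq_right (fe_bl_add_fe_cf_le_one F φ)]

theorem extP_eq_extN_eq_of_BDentails {W : Type} [Nonempty W] (M : BDModel W) {φ χ : BD}
    (h₁ : BDentails φ χ) (h₂ : BDentails χ φ) :
    extP M φ = extP M χ ∧ extN M φ = extN M χ :=
  have h := h₁ W inferInstance M
  have h' := h₂ W inferInstance M
  ⟨h.1.antisymm h'.1, h'.2.antisymm h.2⟩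

theorem fe_ap_congr {W : Type} [Nonempty W] (F : FourModel W) (X : Modality) {φ χ : BD}
    (h₁ : BDentails φ χ) (h₂ : BDentails χ φ) : fe F (X.ap φ) = fe F (X.ap χ) := by
  obtain ⟨hP, hN⟩ := extP_eq_extN_eq_of_BDentails F.M h₁ h₂
  cases X <;> simp only [Modality.ap, fe, extB, extD, extC, extU, hP, hN]

theorem fe_ap_sum_eq_one {W : Type} [Nonempty W] (F : FourModel W) {X₁ X₂ X₃ X₄ : Modality}
    (φ : BD) (h12 : X₁ ≠ X₂) (h13 : X₁ ≠ X₃) (h14 : X₁ ≠ X₄)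
    (h23 : X₂ ≠ X₃) (h24 : X₂ ≠ X₄) (h34 : X₃ ≠ X₄) :
    fe F (X₁.ap φ) + fe F (X₂.ap φ) + fe F (X₃.ap φ) + fe F (X₄.ap φ) = 1 := by
  have hp := F.part φ
  cases X₁ <;> cases X₂ <;> first | contradiction | skip
  all_goals cases X₃ <;> first | contradiction | skip
  all_goals cases X₄ <;> first | contradiction | skip
  all_goals simp only [Modality.ap, fe]; linarith

theorem fe_part2 {W : Type} [Nonempty W] (F : FourModel W) {α β γ δ : FourF}
    (h : fe F α + fe F β + fe F γ + fe F δ = 1) :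
    fe F (((((α.oplus β).oplus γ).oplus δ).ominus δ).biimp ((α.oplus β).oplus γ)) = 1 := by
  apply fe_biimp_eq_one
  have hα := (fe_mem_Icc F α).1
  have hβ := (fe_mem_Icc F β).1
  have hγ := (fe_mem_Icc F γ).1
  have hδ := (fe_mem_Icc F δ).1
  simp only [fe_oplus, fe_ominus]
  grind

theorem fe_bl_add_fe_cf_and_le {W : Type} [Nonempty W] (F : FourModel W) (φ χ : BD) :
    fe F (.bl (.and φ χ)) + fe F (.cf (.and φ χ)) ≤ fe F (.bl φ) + fe F (.cf φ) := by
  refine F.bcmon (.and φ χ) φ (fun w hw => ?_) (fun w hw => ?_)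
  · simp only [extP, Set.mem_ofPred_eq, suppT] at hw ⊢
    exact hw.1
  · simp only [extN, Set.mem_ofPred_eq, suppF] at hw ⊢
    exact Or.inl hw

theorem fe_exax {W : Type} [Nonempty W] (F : FourModel W) (φ χ : BD) :
    fe F ((FourF.bl (.or φ χ)).oplus (.cf (.or φ χ))) =
      fe F (FourF.oplus
        (FourF.ominus ((FourF.bl φ).oplus (.cf φ))
          ((FourF.bl (.and φ χ)).oplus (.cf (.and φ χ))))
        ((FourF.bl χ).oplus (.cf χ))) := by
  have hle := fe_bl_add_fe_cf_and_le F φ χ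
  have hor := fe_bl_add_fe_cf_le_one F (.or φ χ)
  have hex := F.bcex φ χ
  rw [fe_oplus F (FourF.ominus _ _), fe_ominus]
  simp only [fe_bl_oplus_cf]
  simp only [fe] at hle hor ⊢
  rw [max_eq_right (by linarith), min_eq_right (by linarith)]
  linarith

/-- Soundness of H4PrŁΔ: derivability implies semantic entailment in 4PrŁΔ
(in particular every instance of the axioms equiv, contr, neg, mon, part1,
part2 and ex is 4PrŁΔ valid). -/
theorem H4Pr_soundness (Ξ : Set FourF) (α : FourF) (h : Deriv Ξ α) :
    FourEntails Ξ α := by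
  intro W hW F
  induction h with
  | premise hα => exact fun hΞ => hΞ _ hα
  | lax hα =>
    intro _
    rw [← lEval_fe]
    exact hα _ (fe_mem_Icc F)
  | equiv X h₁ h₂ => exact fun _ => fe_biimp_eq_one F (fe_ap_congr F X h₁ h₂)
  | contr1 φ =>
    intro _
    simp only [fe, F.contrb, sub_zero]
  | contr2 φ => exact fun _ => fe_biimp_eq_one F (F.contrc φ).symm
  | negax1 φ => exact fun _ => fe_biimp_eq_one F (F.negb φ)
  | negax2 φ => exact fun _ => fe_biimp_eq_one F (F.negc φ)
  | mon hφχ =>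
    intro _
    apply fe_imp_eq_one
    rw [fe_bl_oplus_cf, fe_bl_oplus_cf]
    have h := hφχ W hW F.M
    exact F.bcmon _ _ h.1 h.2
  | part1 φ =>
    intro _
    have hp := F.part φ
    have hu := (F.mu_mem (extU F.M φ)).1
    have hc := (F.mu_mem (extC F.M φ)).1
    simp only [fe_oplus, fe]
    grind
  | part2 X₁ X₂ X₃ X₄ φ h12 h13 h14 h23 h24 h34 =>
    exact fun _ => fe_part2 F (fe_ap_sum_eq_one F φ h12 h13 h14 h23 h24 h34)
  | exax φ χ => exact fun _ => fe_biimp_eq_one F (fe_exax F φ χ)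
  | @mp Ξ α β _ _ ihα ihαβ =>
    intro hΞ
    have hα := ihα hΞ
    have hαβ := ihαβ hΞ
    simp only [fe, hα, sub_self, zero_add] at hαβ
    exact le_antisymm (fe_mem_Icc F β).2 (min_eq_left_iff.mp hαβ)
  | dnec _ ih =>
    intro _
    simp only [fe, ih (by simp), if_true]
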